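/- If a bounded open set Q ⊂ ℝⁿ satisfies the exterior ball condition, then for every ε > 0 the set Q_ε = {x ∈ Q : dist(x, ∂Q) > ε} also satisfies the exterior ball condition. -/

import Mathlib

open MeasureTheory Topology Filter Set Matrix
open scoped ENNReal NNReal RealInnerProductSpace

noncomputable section

/-- `ℝ^d` with the Euclidean norm. -/
abbrev Vec (d : ℕ) := EuclideanSpace ℝ (Fin d)

/-- `d × d` real matrices. -/
abbrev Mat (d : ℕ) := Matrix (Fin d) (Fin d) ℝ

/-- The canonical path space `Ω_d = C([0,∞); ℝ^d)` with the topology of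
uniform convergence on compact time intervals (= compact-open topology). -/
abbrev PathSp (d : ℕ) := C(ℝ≥0, Vec d)

instance (d : ℕ) : MeasurableSpace (PathSp d) := borel _
instance (d : ℕ) : BorelSpace (PathSp d) := ⟨rfl⟩

/-- Frobenius inner product `⟨A, B⟩ = tr(Aᵀ B)` of matrices. -/
def minner {d : ℕ} (A B : Mat d) : ℝ := (Aᵀ * B).trace

/-- The sublinear function `G(A,p) = sup_{(γ,μ)∈Θ} [½⟨A, γγᵀ⟩ + ⟨p, μ⟩]`. -/
def Gfun {d : ℕ} (Θ : Set (Mat d × Vec d)) (A : Mat d) (p : Vec d) : ℝ :=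
  ⨆ θ : Θ, ((1 : ℝ) / 2 * minner A (θ.1.1 * θ.1.1ᵀ) + ⟪p, θ.1.2⟫)

/-- The natural filtration `F_t = σ(B_s : s ≤ t)` on the path space. -/
def natFilt (d : ℕ) (t : ℝ≥0) : MeasurableSpace (PathSp d) :=
  ⨆ s ∈ {s : ℝ≥0 | s ≤ t}, MeasurableSpace.comap (fun ω : PathSp d => ω s) inferInstance

/-- The upper expectation `Ê[X] = sup_{P ∈ 𝔓} E_P[X]` of a family of probability measures. -/
def upperExp {d : ℕ} (𝔓 : Set (ProbabilityMeasure (PathSp d))) (X : PathSp d → ℝ) : ℝ :=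
  ⨆ P : 𝔓, ∫ ω, X ω ∂(P.1 : Measure (PathSp d))

/-- The capacity `c(A) = sup_{P ∈ 𝔓} P(A)`. -/
def capacity {d : ℕ} (𝔓 : Set (ProbabilityMeasure (PathSp d))) (A : Set (PathSp d)) : ℝ≥0∞ :=
  ⨆ P : 𝔓, (P.1 : Measure (PathSp d)) A

/-- A property holds `𝔓`-quasi-surely if it holds outside a polar set. -/
def QuasiSurely {d : ℕ} (𝔓 : Set (ProbabilityMeasure (PathSp d))) (p : PathSp d → Prop) : Prop :=
  capacity 𝔓 {ω | ¬ p ω} = 0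

/-- Multiplication of a Euclidean vector by a (rectangular) matrix. -/
def matVec {m k : ℕ} (A : Matrix (Fin m) (Fin k) ℝ) (v : Vec k) : Vec m :=
  (EuclideanSpace.equiv (Fin m) ℝ).symm (A.mulVec (EuclideanSpace.equiv (Fin k) ℝ v))

/-- The `i`-th coordinate of a Euclidean vector. -/
def ecoord {d : ℕ} (v : Vec d) : Fin d → ℝ := EuclideanSpace.equiv (Fin d) ℝ v

/-- The basic data of the generalized `G`-expectation framework: a bounded closed set
`Θ ⊂ ℝ^{d×d} × ℝ^d` and the weakly compact family `𝔓` of probability measures on the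
path space representing the `G`-expectation (the weak closure of the laws of the
processes `∫₀^· γ_s dW_s + ∫₀^· μ_s ds`, `(γ,μ)` adapted and `Θ`-valued, `W` a
classical `d`-dimensional Brownian motion). -/
structure GSetting (d : ℕ) where
  Θ : Set (Mat d × Vec d)
  hΘbdd : ∃ C : ℝ, ∀ θ ∈ Θ, (∀ i j, |θ.1 i j| ≤ C) ∧ ‖θ.2‖ ≤ C
  hΘclosed : IsClosed Θ
  𝔓 : Set (ProbabilityMeasure (PathSp d))
  h𝔓ne : 𝔓.Nonempty
  h𝔓cpt : IsCompact 𝔓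

/-- `Σ = {μ : ⟨p,μ⟩ ≤ g(p) = G(0,p) ∀p}`. -/
def SigmaSet {d : ℕ} (Θ : Set (Mat d × Vec d)) : Set (Vec d) :=
  {μ | ∀ p : Vec d, ⟪p, μ⟫ ≤ Gfun Θ 0 p}

/-- `Γ = {γ : ½⟨A, γγᵀ⟩ ≤ G₁(A) = G(A,0) for all symmetric A}`. -/
def GammaSet {d : ℕ} (Θ : Set (Mat d × Vec d)) : Set (Mat d) :=
  {γ | ∀ A : Mat d, A.IsSymm → (1 : ℝ) / 2 * minner A (γ * γᵀ) ≤ Gfun Θ A 0}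

/-- Uniform ellipticity of `G` with parameters `(σ̲², σ̄², β)`:
`σ̲² I ≤ γγᵀ ≤ σ̄² I` and `|μ| ≤ β` for every `(γ,μ) ∈ Θ`. -/
def UnifElliptic {d : ℕ} (Θ : Set (Mat d × Vec d)) (sl su β : ℝ) : Prop :=
  0 < sl ∧ sl ≤ su ∧ 0 ≤ β ∧
    ∀ θ ∈ Θ, (∀ v : Vec d,
      sl * ‖v‖ ^ 2 ≤ ‖matVec θ.1ᵀ v‖ ^ 2 ∧ ‖matVec θ.1ᵀ v‖ ^ 2 ≤ su * ‖v‖ ^ 2) ∧ ‖θ.2‖ ≤ β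

/-- Data of the `G`-SDE `dX^x_t = b(X^x_t) dt + Σ_j σ_j(X^x_t) dB^j_t`, `X^x_0 = x`,
driven by the generalized `G`-Brownian motion: Lipschitz coefficients together with the
solution map `x ↦ X^x` (a measurable map from `Ω_d` to `Ω_n`). -/
structure GSDE (d n : ℕ) where
  b : Vec n → Vec n
  σv : Fin d → Vec n → Vec n
  hb : ∃ L : ℝ≥0, LipschitzWith L b
  hσ : ∀ j, ∃ L : ℝ≥0, LipschitzWith L (σv j)
  X : Vec n → PathSp d → PathSp n
  hXmeas : ∀ x, Measurable (X x)
  hX0 : ∀ x ω, X x ω 0 = x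

/-- Non-degeneracy of `σ` on `Q̄`: `λ I ≤ σ(y)σ(y)ᵀ` for all `y ∈ Q̄`. -/
def NonDeg {d n : ℕ} (σv : Fin d → Vec n → Vec n) (Q : Set (Vec n)) (lam : ℝ) : Prop :=
  0 < lam ∧ ∀ y ∈ closure Q, ∀ v : Vec n, lam * ‖v‖ ^ 2 ≤ ∑ j : Fin d, ⟪σv j y, v⟫ ^ 2

/-- The exterior ball condition for an open set. -/
def ExteriorBallCond {n : ℕ} (O : Set (Vec n)) : Prop :=
  ∀ x ∈ frontier O, ∃ z : Vec n, ∃ r : ℝ, 0 < r ∧ Metric.ball z r ⊆ Oᶜ ∧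
    x ∈ frontier (Metric.ball z r)

/-- The exit time `inf {t ≥ 0 : ω(t) ∈ Dᶜ}` (with value `∞` if the path never leaves `D`). -/
def exitTime {n : ℕ} (ω : PathSp n) (D : Set (Vec n)) : ℝ≥0∞ :=
  sInf ((fun s : ℝ≥0 => (s : ℝ≥0∞)) '' {s : ℝ≥0 | ω s ∉ D})


/-- If a bounded open set `Q ⊂ ℝⁿ` satisfies the exterior ball condition, then for
every `ε > 0` the inner approximation `Q_ε = {x ∈ Q : dist(x, ∂Q) > ε}` also satisfies the
exterior ball condition. -/
theorem inner_approximation_exterior_ball (n : ℕ) (Q : Set (Vec n))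
    (hQo : IsOpen Q) (hQb : Bornology.IsBounded Q) (hQ : ExteriorBallCond Q)
    (ε : ℝ) (hε : 0 < ε) :
    ExteriorBallCond {x | x ∈ Q ∧ ε < Metric.infDist x (frontier Q)} := by
  have hcont := Metric.continuous_infDist_pt (frontier Q)
  have hopen : IsOpen {x | x ∈ Q ∧ ε < Metric.infDist x (frontier Q)} :=
    hQo.inter (isOpen_lt continuous_const hcont)
  intro x hx
  rw [hopen.frontier_eq] at hx
  obtain ⟨hxc, hxn⟩ := hx
  have hle : ε ≤ Metric.infDist x (frontier Q) :=
    closure_minimal (fun y hy => hy.2.le) (isClosed_le continuous_const hcont) hxc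
  have hxQ : x ∈ Q := by
    by_contra h
    have hxf : x ∈ frontier Q := by
      rw [hQo.frontier_eq]
      exact ⟨closure_mono (fun y hy => hy.1) hxc, h⟩
    rw [Metric.infDist_zero_of_mem hxf] at hle
    linarith
  have heq : Metric.infDist x (frontier Q) = ε :=
    le_antisymm (not_lt.mp fun h => hxn ⟨hxQ, h⟩) hle
  have hne : (frontier Q).Nonempty := by
    by_contra h
    rw [Set.not_nonempty_iff_eq_empty.mp h, Metric.infDist_empty] at hle
    linarith
  obtain ⟨y, hy, hxy⟩ := isClosed_frontier.exists_infDist_eq_dist hne x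
  refine ⟨y, ε, hε, fun w hw hwQ => ?_, ?_⟩
  · exact absurd ((Metric.infDist_le_dist_of_mem hy).trans_lt hw) hwQ.2.le.not_gt
  · rw [frontier_ball y hε.ne', Metric.mem_sphere, ← hxy, heq]

end
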